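/- Let Σ be a complete simplicial fan in ℚ^n with cones spanned by linearly independent subsets of fixed vectors y_1, …, y_N ∈ ℤ^n, and write Gen(Σ) = {y_{N+1}, …, y_M}. Let I ⊆ {1, …, M} be a generalized primitive collection and set w = Σ_{k∈I} y_k. Then there exists a cone σ(I) ∈ Σ containing w, and for any such cone there exist nonnegative integers c_j, indexed by those j ∈ {1, …, M} with y_j ∈ σ(I), such that Σ_{k∈I} y_k = Σ_{j : y_j ∈ σ(I)} c_j y_j. -/

import Mathlib

/-- Coordinatewise cast of a lattice vector in `ℤ^n` to `ℚ^n`. -/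
def castQ {n : ℕ} (v : Fin n → ℤ) : Fin n → ℚ := fun i => (v i : ℚ)

/-- The simplicial cone in `ℚ^n` spanned (with nonnegative rational coefficients)
by the vectors `y j`, `j ∈ S`. -/
def coneOf {n M : ℕ} (y : Fin M → Fin n → ℤ) (S : Finset (Fin M)) : Set (Fin n → ℚ) :=
  {v | ∃ a : Fin M → ℚ, (∀ j ∈ S, 0 ≤ a j) ∧ v = ∑ j ∈ S, a j • castQ (y j)}

/-- `SBox(σ)`: lattice points expressible as `∑ a_j • y_j` with `0 ≤ a_j < 1`. -/
def sboxOf {n M : ℕ} (y : Fin M → Fin n → ℤ) (S : Finset (Fin M)) : Set (Fin n → ℤ) :=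
  {b | ∃ a : Fin M → ℚ, (∀ j ∈ S, 0 ≤ a j ∧ a j < 1) ∧
    castQ b = ∑ j ∈ S, a j • castQ (y j)}

/-- `Gen(σ)`: the nonzero elements of `SBox(σ)` that are irreducible in the monoid
of lattice points of `σ`, i.e. not a sum of two nonzero lattice points of `σ`. -/
def genOf {n M : ℕ} (y : Fin M → Fin n → ℤ) (S : Finset (Fin M)) : Set (Fin n → ℤ) :=
  {b | b ∈ sboxOf y S ∧ b ≠ 0 ∧
    ¬ ∃ u w : Fin n → ℤ, u ≠ 0 ∧ w ≠ 0 ∧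
      castQ u ∈ coneOf y S ∧ castQ w ∈ coneOf y S ∧ b = u + w}

theorem castQ_add {n : ℕ} (u v : Fin n → ℤ) : castQ (u + v) = castQ u + castQ v := by
  ext i; simp [castQ]

theorem castQ_sub {n : ℕ} (u v : Fin n → ℤ) : castQ (u - v) = castQ u - castQ v := by
  ext i; simp [castQ]

theorem castQ_zero {n : ℕ} : castQ (0 : Fin n → ℤ) = 0 := by
  ext i; simp [castQ]

theorem castQ_eq_zero {n : ℕ} {v : Fin n → ℤ} (h : castQ v = 0) : v = 0 := by
  ext i; simpa [castQ] using congrFun h i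

theorem generator_mem_coneOf {n M : ℕ} (y : Fin M → Fin n → ℤ) {S : Finset (Fin M)} {j : Fin M}
    (hj : j ∈ S) : castQ (y j) ∈ coneOf y S := by
  refine ⟨Pi.single j 1, fun i _ => ?_, ?_⟩
  · by_cases h : i = j
    · subst h; simp
    · simp [h]
  · simp [Pi.single_apply, hj]

/-- A linear functional on `ℚ^n` becomes integral on `ℤ^n` after scaling by a positive integer. -/
theorem exists_pos_smul_integral {n : ℕ} (f : (Fin n → ℚ) →ₗ[ℚ] ℚ) :
    ∃ D : ℕ, 0 < D ∧ ∀ v : Fin n → ℤ, ∃ z : ℤ, (D : ℚ) * f (castQ v) = z := by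
  refine ⟨∏ i, (f (Pi.single i 1)).den, Finset.prod_pos fun i _ => Rat.den_pos _, fun v => ?_⟩
  have hint : ∀ i, ∃ z : ℤ, ((∏ i, (f (Pi.single i 1)).den : ℕ) : ℚ) * f (Pi.single i 1) = z := by
    intro i
    obtain ⟨k, hk⟩ := Finset.dvd_prod_of_mem (fun i => (f (Pi.single i 1)).den)
      (Finset.mem_univ i)
    refine ⟨k * (f (Pi.single i 1)).num, ?_⟩
    rw [hk]
    push_cast
    rw [mul_right_comm, Rat.den_mul_eq_num]
    ring
  choose z hz using hint
  refine ⟨∑ i, v i * z i, ?_⟩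
  have hbasis : ∀ i : Fin n, (fun j => if i = j then (1 : ℚ) else 0) = Pi.single i 1 := by
    intro i
    ext j
    simp [Pi.single_apply, eq_comm]
  rw [f.pi_apply_eq_sum_univ, Finset.mul_sum]
  push_cast
  refine Finset.sum_congr rfl fun i _ => ?_
  rw [← hz i, hbasis, smul_eq_mul, mul_left_comm]
  simp [castQ]

/-- Linearly independent lattice vectors admit a common linear functional that is integral on the
lattice and positive on each of them. -/
theorem exists_integral_pos_functional {n M : ℕ} (y : Fin M → Fin n → ℤ) (S : Finset (Fin M))
    (hLI : LinearIndependent ℚ (fun j : S => castQ (y (j : Fin M)))) :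
    ∃ f : (Fin n → ℚ) →ₗ[ℚ] ℚ, (∀ j ∈ S, 0 < f (castQ (y j))) ∧
      ∀ v : Fin n → ℤ, ∃ z : ℤ, f (castQ v) = z := by
  obtain ⟨f, hf⟩ := LinearMap.exists_extend
    ((Module.Basis.span hLI).constr ℚ (fun _ => (1 : ℚ)))
  have hf1 : ∀ j ∈ S, f (castQ (y j)) = 1 := by
    intro j hj
    have h := (Module.Basis.span hLI).constr_basis ℚ (fun _ => (1 : ℚ)) ⟨j, hj⟩
    rw [← hf] at h
    simpa [Module.Basis.span_apply] using h
  obtain ⟨D, hD, hint⟩ := exists_pos_smul_integral f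
  refine ⟨(D : ℚ) • f, fun j hj => ?_, fun v => by simpa using hint v⟩
  simpa [hf1 j hj] using hD

theorem functional_pos_of_mem_coneOf {n M : ℕ} {y : Fin M → Fin n → ℤ} {S : Finset (Fin M)}
    {f : (Fin n → ℚ) →ₗ[ℚ] ℚ} (hf : ∀ j ∈ S, 0 < f (castQ (y j))) {v : Fin n → ℚ}
    (hv : v ∈ coneOf y S) (hv0 : v ≠ 0) : 0 < f v := by
  obtain ⟨a, ha, rfl⟩ := hv
  have hnn : ∀ j ∈ S, 0 ≤ a j * f (castQ (y j)) := fun j hj => mul_nonneg (ha j hj) (hf j hj).le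
  simp only [map_sum, map_smul, smul_eq_mul]
  refine (Finset.sum_nonneg hnn).lt_of_ne' fun h => hv0 ?_
  rw [Finset.sum_eq_zero_iff_of_nonneg hnn] at h
  refine Finset.sum_eq_zero fun j hj => ?_
  rw [(mul_eq_zero.mp (h j hj)).resolve_right (hf j hj).ne', zero_smul]

/-- A lattice point of a simplicial cone that is irreducible in its monoid of lattice points is
either one of the spanning vectors or an element of `Gen`. -/
theorem mem_genOf_or_eq_generator {n M : ℕ} {y : Fin M → Fin n → ℤ} {S : Finset (Fin M)}
    (hy : ∀ j ∈ S, y j ≠ 0) {w : Fin n → ℤ} (hw : castQ w ∈ coneOf y S) (hw0 : w ≠ 0)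
    (hirr : ¬ ∃ u v : Fin n → ℤ, u ≠ 0 ∧ v ≠ 0 ∧
      castQ u ∈ coneOf y S ∧ castQ v ∈ coneOf y S ∧ w = u + v) :
    w ∈ genOf y S ∨ ∃ j ∈ S, w = y j := by
  obtain ⟨a, ha, hwa⟩ := hw
  by_cases hlt : ∀ j ∈ S, a j < 1
  · exact Or.inl ⟨⟨a, fun j hj => ⟨ha j hj, hlt j hj⟩, hwa⟩, hw0, hirr⟩
  · push Not at hlt
    obtain ⟨j, hj, h1⟩ := hlt
    refine Or.inr ⟨j, hj, ?_⟩
    by_contra hne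
    refine hirr ⟨y j, w - y j, hy j hj, sub_ne_zero.mpr hne, generator_mem_coneOf y hj,
      ⟨a - Pi.single j 1, fun i hi => ?_, ?_⟩, by abel⟩
    · by_cases h : i = j
      · subst h; simpa using h1
      · simpa [h] using ha i hi
    · rw [castQ_sub, hwa]
      simp [sub_smul, Pi.single_apply, hj]

/-- Every lattice point of a simplicial cone is a nonnegative integer combination of those listed
vectors lying in the cone, provided the list contains `Gen` of the cone. -/
theorem exists_nat_combination_of_mem_coneOf {n M : ℕ} {y : Fin M → Fin n → ℤ}
    {S : Finset (Fin M)}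
    (hLI : LinearIndependent ℚ (fun j : S => castQ (y (j : Fin M))))
    (hGen : genOf y S ⊆ Set.range y) {w : Fin n → ℤ} (hw : castQ w ∈ coneOf y S) :
    ∃ c : Fin M → ℕ, (∀ j, c j ≠ 0 → castQ (y j) ∈ coneOf y S) ∧
      w = ∑ j, (c j : ℤ) • y j := by
  obtain ⟨f, hf, hint⟩ := exists_integral_pos_functional y S hLI
  choose z hz using hint
  have hpos : ∀ v : Fin n → ℤ, castQ v ∈ coneOf y S → v ≠ 0 → 0 < z v := by
    intro v hv hv0
    have := functional_pos_of_mem_coneOf hf hv fun h => hv0 (castQ_eq_zero h)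
    rw [hz] at this
    exact_mod_cast this
  have hadd : ∀ u v, z (u + v) = z u + z v := by
    intro u v
    have := hz (u + v)
    rw [castQ_add, map_add, hz, hz] at this
    exact_mod_cast this.symm
  have hy : ∀ j ∈ S, y j ≠ 0 := fun j hj h => hLI.ne_zero ⟨j, hj⟩ (by
    simp only [h, castQ_zero])
  induction hk : (z w).toNat using Nat.strong_induction_on generalizing w with
  | _ k ih =>
    subst hk
    by_cases hw0 : w = 0
    · exact ⟨0, by simp, by simp [hw0]⟩
    by_cases hirr : ∃ u v : Fin n → ℤ, u ≠ 0 ∧ v ≠ 0 ∧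
        castQ u ∈ coneOf y S ∧ castQ v ∈ coneOf y S ∧ w = u + v
    · obtain ⟨u, v, hu0, hv0, hu, hv, rfl⟩ := hirr
      have hzu := hpos u hu hu0
      have hzv := hpos v hv hv0
      have hzuv := hadd u v
      obtain ⟨c, hc, hcu⟩ := ih (z u).toNat (by omega) hu rfl
      obtain ⟨d, hd, hdv⟩ := ih (z v).toNat (by omega) hv rfl
      refine ⟨c + d, fun j hj => ?_, ?_⟩
      · by_cases h : c j = 0
        · exact hd j fun h' => hj (by simp [h, h'])
        · exact hc j h
      · simp only [Pi.add_apply, Nat.cast_add, add_smul, Finset.sum_add_distrib]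
        rw [← hcu, ← hdv]
    · have hlisted : ∃ j, y j = w := by
        rcases mem_genOf_or_eq_generator hy hw hw0 hirr with h | ⟨j, -, h⟩
        · exact hGen h
        · exact ⟨j, h.symm⟩
      obtain ⟨j, rfl⟩ := hlisted
      refine ⟨Pi.single j 1, fun i hi => ?_, ?_⟩
      · by_cases h : i = j
        · rwa [h]
        · simp [h] at hi
      · simp [Pi.single_apply]

/-- Let `Σ` be a complete simplicial fan in `ℚ^n` whose cones are spanned by linearly
independent subsets of `y 1, …, y N`, and let `y (N+1), …, y M` comprise `Gen(Σ)`.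
If `I` is a generalized primitive collection and `w = ∑_{k ∈ I} y k`, then some cone
`σ(I)` of the fan contains `w`, and for any such cone there are nonnegative integers
`c j`, supported on those `j` with `y j ∈ σ(I)`, with `∑_{k∈I} y k = ∑_j c j • y j`. -/
theorem primitive_collection_relation {n N M : ℕ} (hNM : N ≤ M)
    (y : Fin M → Fin n → ℤ)
    (Fan : Finset (Finset (Fin M)))
    -- the cones of the fan are spanned by (subsets of) the first `N` vectors
    (hray : ∀ S ∈ Fan, ∀ j ∈ S, (j : ℕ) < N)
    -- each cone is simplicial
    (hLI : ∀ S ∈ Fan, LinearIndependent ℚ (fun j : S => castQ (y (j : Fin M))))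
    -- the fan is complete
    (hcomplete : ∀ v : Fin n → ℚ, ∃ S ∈ Fan, v ∈ coneOf y S)
    -- `Gen(Σ)` is listed among the vectors `y (N+1), …, y M`
    (hGen : ∀ S ∈ Fan, genOf y S ⊆ {v | ∃ j : Fin M, N ≤ (j : ℕ) ∧ v = y j})
    (I : Finset (Fin M))
    -- `I` is a generalized primitive collection:
    (hI₁ : ¬ ∃ S ∈ Fan, ∀ k ∈ I, castQ (y k) ∈ coneOf y S)
    (hI₂ : ∀ J : Finset (Fin M), J ⊂ I → ∃ S ∈ Fan, ∀ k ∈ J, castQ (y k) ∈ coneOf y S) :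
    (∃ S ∈ Fan, castQ (∑ k ∈ I, y k) ∈ coneOf y S) ∧
    (∀ S' ∈ Fan, castQ (∑ k ∈ I, y k) ∈ coneOf y S' →
      ∃ c : Fin M → ℕ, (∀ j, c j ≠ 0 → castQ (y j) ∈ coneOf y S') ∧
        (∑ k ∈ I, y k) = ∑ j, (c j : ℤ) • y j) := by
  refine ⟨hcomplete _, fun S hS hw => ?_⟩
  refine exists_nat_combination_of_mem_coneOf (hLI S hS) (fun v hv => ?_) hw
  obtain ⟨j, -, h⟩ := hGen S hS hv
  exact ⟨j, h.symm⟩
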